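/- Let n ≥ 2. Then sl_{2n}(ℝ) = sp(2n,ℝ) ⊕ W as vector spaces, W is invariant under the adjoint action of sp(2n,ℝ) (i.e., [Y, X] ∈ W for all Y ∈ sp(2n,ℝ) and X ∈ W), and W is irreducible as an sp(2n,ℝ)-module: the only linear subspaces W' ⊆ W satisfying [sp(2n,ℝ), W'] ⊆ W' are {0} and W. -/

import Mathlib

open Matrix

noncomputable section

abbrev Mat (n : ℕ) := Matrix (Fin (2*n)) (Fin (2*n)) ℝ

/-- The standard symplectic matrix `J_n` with block form `(0 Iₙ; -Iₙ 0)`. -/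
def Jmat (n : ℕ) : Mat n :=
  fun i j => if (i : ℕ) + n = (j : ℕ) then 1 else if (j : ℕ) + n = (i : ℕ) then -1 else 0

/-- The symplectic Lie algebra `sp(2n,ℝ) = {X ∈ sl_{2n}(ℝ) : Xᵀ Jₙ + Jₙ X = 0}`. -/
def spSet (n : ℕ) : Set (Mat n) := {X | X.trace = 0 ∧ Xᵀ * Jmat n + Jmat n * X = 0}

/-- The complement `W = {X ∈ sl_{2n}(ℝ) : Jₙ X is skew-symmetric}`. -/
def WSet (n : ℕ) : Set (Mat n) := {X | X.trace = 0 ∧ (Jmat n * X)ᵀ = -(Jmat n * X)}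

theorem Jmat_transpose (n : ℕ) (hn : 2 ≤ n) : (Jmat n)ᵀ = - Jmat n := by
  ext i j
  simp only [Matrix.transpose_apply, Matrix.neg_apply, Jmat]
  split_ifs <;> first | omega | simp

theorem Jmat_mul_self (n : ℕ) (hn : 2 ≤ n) : Jmat n * Jmat n = -1 := by
  ext i j
  rw [Matrix.mul_apply, Matrix.neg_apply, Matrix.one_apply]
  have hi := i.2
  have hj := j.2
  by_cases h : (i : ℕ) < n
  · rw [Finset.sum_eq_single (⟨i + n, by omega⟩ : Fin (2*n))]
    · simp only [Jmat, Fin.ext_iff]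
      split_ifs <;> first | omega | simp
    · intro k _ hk
      have hk' : (i : ℕ) + n ≠ k := fun h => hk (by ext; simp [h])
      have : Jmat n i k = 0 := by
        simp only [Jmat]
        split_ifs <;> first | omega | simp
      rw [this, zero_mul]
    · simp
  · rw [Finset.sum_eq_single (⟨i - n, by omega⟩ : Fin (2*n))]
    · simp only [Jmat, Fin.ext_iff]
      split_ifs <;> first | omega | simp
    · intro k _ hk
      have hk' : (i : ℕ) - n ≠ k := fun h => hk (by ext; simp [h])
      have hk2 := k.2
      have : Jmat n i k = 0 := by
        simp only [Jmat]
        split_ifs <;> first | omega | simp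
      rw [this, zero_mul]
    · simp

theorem mem_sp (n : ℕ) (X : Mat n) :
    X ∈ spSet n ↔ X.trace = 0 ∧ Xᵀ * Jmat n = - (Jmat n * X) := by
  simp [spSet, add_eq_zero_iff_eq_neg]

theorem mem_W (n : ℕ) (hn : 2 ≤ n) (X : Mat n) :
    X ∈ WSet n ↔ X.trace = 0 ∧ Xᵀ * Jmat n = Jmat n * X := by
  simp [WSet, Matrix.transpose_mul, Jmat_transpose n hn]

theorem JJ_mul (n : ℕ) (hn : 2 ≤ n) (X : Mat n) : Jmat n * (Jmat n * X) = -X := by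
  rw [← Matrix.mul_assoc, Jmat_mul_self n hn]; simp

theorem part1 (n : ℕ) (hn : 2 ≤ n) (X : Mat n) (hX : X.trace = 0) :
    ∃! p : Mat n × Mat n, p.1 ∈ spSet n ∧ p.2 ∈ WSet n ∧ X = p.1 + p.2 := by
  have hJJ := JJ_mul n hn
  have hJ2 := Jmat_mul_self n hn
  have hJt := Jmat_transpose n hn
  have htr : (Jmat n * (Xᵀ * Jmat n)).trace = 0 := by
    rw [Matrix.trace_mul_comm, Matrix.mul_assoc, hJ2]; simp [hX]
  refine ⟨((1/2 : ℝ) • (X + Jmat n * (Xᵀ * Jmat n)), (1/2 : ℝ) • (X - Jmat n * (Xᵀ * Jmat n))),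
    ⟨?_, ?_, ?_⟩, ?_⟩
  · rw [mem_sp]
    refine ⟨by simp [htr, hX], ?_⟩
    simp only [Matrix.transpose_smul, Matrix.transpose_add, Matrix.transpose_mul, hJt,
      Matrix.transpose_transpose, Matrix.smul_mul, Matrix.mul_smul, Matrix.add_mul, Matrix.mul_add,
      hJJ, Matrix.mul_assoc, Matrix.neg_mul, Matrix.mul_neg, hJ2, Matrix.mul_one, neg_neg]
    module
  · rw [mem_W n hn]
    refine ⟨by simp [htr, hX], ?_⟩
    simp only [Matrix.transpose_smul, Matrix.transpose_sub, Matrix.transpose_mul, hJt,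
      Matrix.transpose_transpose, Matrix.smul_mul, Matrix.mul_smul, Matrix.sub_mul, Matrix.mul_sub,
      hJJ, Matrix.mul_assoc, Matrix.neg_mul, Matrix.mul_neg, hJ2, Matrix.mul_one, neg_neg]
    module
  · simp only; module
  · rintro ⟨p, q⟩ ⟨hp, hq, rfl⟩
    rw [mem_sp] at hp
    rw [mem_W n hn] at hq
    simp only [Matrix.transpose_add, Matrix.add_mul] at *
    rw [hp.2, hq.2]
    simp only [Matrix.mul_add, Matrix.mul_neg, hJJ]
    ext1
    · simp only; module
    · simp only; module

theorem part2 (n : ℕ) (hn : 2 ≤ n) (Y : Mat n) (hY : Y ∈ spSet n) (X : Mat n) (hX : X ∈ WSet n) :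
    Y * X - X * Y ∈ WSet n := by
  rw [mem_sp] at hY
  rw [mem_W n hn] at hX ⊢
  refine ⟨by rw [Matrix.trace_sub, Matrix.trace_mul_comm, sub_self], ?_⟩
  rw [Matrix.transpose_sub, Matrix.transpose_mul, Matrix.transpose_mul, Matrix.sub_mul,
    Matrix.mul_assoc, Matrix.mul_assoc, hY.2, hX.2, Matrix.mul_neg, ← Matrix.mul_assoc,
    ← Matrix.mul_assoc, hY.2, hX.2]
  noncomm_ring

def om (n : ℕ) (u v : Fin (2*n) → ℝ) : ℝ := u ⬝ᵥ (Jmat n *ᵥ v)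

def br (n : ℕ) (u v : Fin (2*n) → ℝ) : Mat n := (vecMulVec u v - vecMulVec v u) * Jmat n

section
variable {n : ℕ}

theorem om_add_left (u u' v : Fin (2*n) → ℝ) : om n (u+u') v = om n u v + om n u' v := by
  simp [om, add_dotProduct]
theorem om_add_right (u v v' : Fin (2*n) → ℝ) : om n u (v+v') = om n u v + om n u v' := by
  simp [om, Matrix.mulVec_add]
theorem om_smul_left (c : ℝ) (u v : Fin (2*n) → ℝ) : om n (c • u) v = c * om n u v := by
  simp [om]
theorem om_smul_right (c : ℝ) (u v : Fin (2*n) → ℝ) : om n u (c • v) = c * om n u v := by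
  simp [om, Matrix.mulVec_smul]
theorem om_swap (hn : 2 ≤ n) (u v : Fin (2*n) → ℝ) : om n v u = - om n u v := by
  have h := Jmat_transpose n hn
  unfold om
  rw [Matrix.dotProduct_mulVec, ← Matrix.mulVec_transpose, h, dotProduct_comm]
  simp [Matrix.neg_mulVec]
theorem om_self (hn : 2 ≤ n) (u : Fin (2*n) → ℝ) : om n u u = 0 := by
  have := om_swap hn u u
  linarith
theorem om_nondeg (hn : 2 ≤ n) (u : Fin (2*n) → ℝ) (h : ∀ a, om n u a = 0) : u = 0 := by
  have := h (- (Jmat n *ᵥ u))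
  unfold om at this
  rw [Matrix.mulVec_neg, Matrix.mulVec_mulVec, Jmat_mul_self n hn] at this
  simpa [Matrix.neg_mulVec] using this

theorem br_add_left (u u' v : Fin (2*n) → ℝ) : br n (u+u') v = br n u v + br n u' v := by
  simp only [br, Matrix.vecMulVec_add, Matrix.add_vecMulVec, ← Matrix.add_mul]
  congr 1; abel
theorem br_smul_left (c : ℝ) (u v : Fin (2*n) → ℝ) : br n (c • u) v = c • br n u v := by
  simp only [br, Matrix.vecMulVec_smul, Matrix.smul_vecMulVec, ← Matrix.smul_mul, smul_sub]
theorem br_swap (u v : Fin (2*n) → ℝ) : br n v u = - br n u v := by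
  simp only [br, ← Matrix.neg_mul, neg_sub]
theorem br_add_right (u v v' : Fin (2*n) → ℝ) : br n u (v+v') = br n u v + br n u v' := by
  rw [br_swap, br_add_left, br_swap u v, br_swap u v']; abel
theorem br_smul_right (c : ℝ) (u v : Fin (2*n) → ℝ) : br n u (c • v) = c • br n u v := by
  rw [br_swap, br_smul_left, br_swap u v]; simp
theorem br_self (u : Fin (2*n) → ℝ) : br n u u = 0 := by simp [br]
theorem br_mulVec (v w a : Fin (2*n) → ℝ) :
    br n v w *ᵥ a = om n w a • v + (-om n v a) • w := by
  unfold br om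
  rw [← Matrix.mulVec_mulVec, Matrix.sub_mulVec, Matrix.vecMulVec_mulVec, Matrix.vecMulVec_mulVec]
  ext i
  simp
  ring
theorem br_trace (hn : 2 ≤ n) (u v : Fin (2*n) → ℝ) : (br n u v).trace = -2 * om n u v := by
  have h : ∀ u v : Fin (2*n) → ℝ, (vecMulVec u v * Jmat n).trace = om n v u := by
    intro u v
    rw [Matrix.trace_mul_comm, Matrix.mul_vecMulVec, Matrix.trace_vecMulVec, dotProduct_comm, om]
  rw [br, Matrix.sub_mul, Matrix.trace_sub, h, h, om_swap hn u v]; ring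

theorem act (hn : 2 ≤ n) (W' : Submodule ℝ (Mat n)) (hW : (W' : Set (Mat n)) ⊆ WSet n)
    (h : ∀ Y ∈ spSet n, ∀ X ∈ W', Y * X - X * Y ∈ W') (X : Mat n) (hX : X ∈ W')
    (v : Fin (2*n) → ℝ) : br n v (X *ᵥ v) ∈ W' := by
  have hX' := (mem_W n hn X).1 (hW hX)
  have hY : vecMulVec v v * Jmat n ∈ spSet n := by
    rw [mem_sp]
    constructor
    · rw [Matrix.trace_mul_comm, Matrix.mul_vecMulVec, Matrix.trace_vecMulVec, dotProduct_comm]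
      exact om_self hn v
    · rw [Matrix.transpose_mul, Jmat_transpose n hn, Matrix.transpose_vecMulVec, Matrix.neg_mul,
        Matrix.neg_mul, Matrix.mul_assoc]
  have := h _ hY X hX
  convert this using 1
  rw [Matrix.mul_assoc, ← hX'.2, ← Matrix.mul_assoc, ← Matrix.mul_assoc, Matrix.vecMulVec_mul,
    Matrix.mul_vecMulVec, Matrix.vecMul_transpose, br, Matrix.sub_mul]

theorem exists_sep (hn : 2 ≤ n) (v w : Fin (2*n) → ℝ) (hv : v ≠ 0) (hw : ∀ c : ℝ, w ≠ c • v) :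
    ∃ a, om n v a = 0 ∧ om n w a ≠ 0 := by
  by_contra! hcon
  obtain ⟨a0, ha0⟩ : ∃ a, om n v a ≠ 0 := by
    by_contra! h
    exact hv (om_nondeg hn v h)
  apply hw (om n w a0 / om n v a0)
  rw [← sub_eq_zero]
  apply om_nondeg hn
  intro a
  have := hcon (a + (-(om n v a / om n v a0)) • a0) (by
    rw [om_add_right, om_smul_right]; field_simp; ring)
  rw [om_add_right, om_smul_right] at this
  rw [sub_eq_add_neg, ← neg_smul, om_add_left, om_smul_left]
  field_simp at this ⊢
  linarith

theorem stepP (hn : 2 ≤ n) (W' : Submodule ℝ (Mat n)) (hW : (W' : Set (Mat n)) ⊆ WSet n)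
    (h : ∀ Y ∈ spSet n, ∀ X ∈ W', Y * X - X * Y ∈ W') (v w : Fin (2*n) → ℝ) (hv : v ≠ 0)
    (hw : ∀ c : ℝ, w ≠ c • v) (hvw : br n v w ∈ W') (c : Fin (2*n) → ℝ) (hc : om n v c = 0) :
    br n v c ∈ W' := by
  have key : ∀ a, om n v a = 0 → om n w a ≠ 0 → br n v a ∈ W' := by
    intro a ha ha'
    have := act hn W' hW h _ hvw a
    rw [br_mulVec, ha, neg_zero, zero_smul, add_zero, br_smul_right, br_swap v a] at this
    have h2 := W'.smul_mem (-(om n w a)⁻¹) this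
    rw [neg_smul, smul_neg, smul_neg, neg_neg, smul_smul, inv_mul_cancel₀ ha', one_smul] at h2
    exact h2
  by_cases h0 : om n w c = 0
  · obtain ⟨a, ha, ha'⟩ := exists_sep hn v w hv hw
    have h1 := key (c + a) (by rw [om_add_right, hc, ha, add_zero])
      (by rwa [om_add_right, h0, zero_add])
    have h2 := W'.sub_mem h1 (key a ha ha')
    rwa [br_add_right, add_sub_cancel_right] at h2
  · exact key c hc h0

theorem exists_perp (hn : 2 ≤ n) (u v : Fin (2*n) → ℝ) :
    ∃ a, a ≠ 0 ∧ om n u a = 0 ∧ om n v a = 0 := by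
  let f : (Fin (2*n) → ℝ) →ₗ[ℝ] (Fin 2 → ℝ) :=
    { toFun := fun a => ![om n u a, om n v a]
      map_add' := by intro a b; ext i; fin_cases i <;> simp [om_add_right]
      map_smul' := by intro a b; ext i; fin_cases i <;> simp [om_smul_right] }
  have hf : LinearMap.ker f ≠ ⊥ := by
    apply LinearMap.ker_ne_bot_of_finrank_lt
    simp
    omega
  obtain ⟨a, ha, ha0⟩ := (Submodule.ne_bot_iff _).1 hf
  have ha' : ![om n u a, om n v a] = 0 := ha
  exact ⟨a, ha0, by simpa using congrFun ha' 0, by simpa using congrFun ha' 1⟩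

theorem stepAll (hn : 2 ≤ n) (W' : Submodule ℝ (Mat n)) (hW : (W' : Set (Mat n)) ⊆ WSet n)
    (h : ∀ Y ∈ spSet n, ∀ X ∈ W', Y * X - X * Y ∈ W') (v w : Fin (2*n) → ℝ) (hv : v ≠ 0)
    (hw : ∀ c : ℝ, w ≠ c • v) (hvw : br n v w ∈ W') (u c : Fin (2*n) → ℝ) (hc : om n u c = 0) :
    br n u c ∈ W' := by
  have P1 := stepP hn W' hW h v w hv hw hvw
  have tr : ∀ v : Fin (2*n) → ℝ, v ≠ 0 → (∀ c, om n v c = 0 → br n v c ∈ W') →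
      ∀ u, om n v u = 0 → ∀ c, om n u c = 0 → br n u c ∈ W' := by
    intro v hv P u hu c hc
    by_cases hd : ∃ t : ℝ, u = t • v
    · obtain ⟨t, rfl⟩ := hd
      rw [om_smul_left] at hc
      rw [br_smul_left]
      by_cases ht : t = 0
      · simp [ht]
      · exact W'.smul_mem _ (P c (by simpa [ht] using hc))
    · push Not at hd
      have hu0 : u ≠ 0 := by simpa using hd 0
      refine stepP hn W' hW h u v hu0 ?_ ?_ c hc
      · intro t ht
        have ht0 : t ≠ 0 := by
          rintro rfl
          exact hv (by simpa using ht)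
        apply hd t⁻¹
        rw [ht, smul_smul, inv_mul_cancel₀ ht0, one_smul]
      · rw [br_swap]
        exact W'.neg_mem (P u hu)
  obtain ⟨a, ha0, hva, hua⟩ := exists_perp hn v u
  have P2 := tr v hv P1 a hva
  exact tr a ha0 P2 u (by rw [om_swap hn, hua, neg_zero]) c hc

theorem om_prop (hn : 2 ≤ n) (f : Mat n →ₗ[ℝ] ℝ)
    (hf : ∀ u c, om n u c = 0 → f (br n u c) = 0) :
    ∃ l : ℝ, ∀ u c, f (br n u c) = l * om n u c := by
  have L : ∀ u u' c, om n u c * f (br n u' c) = om n u' c * f (br n u c) := by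
    intro u u' c
    have := hf (om n u c • u' + (- om n u' c) • u) c (by
      rw [om_add_left, om_smul_left, om_smul_left]; ring)
    rw [br_add_left, br_smul_left, br_smul_left, map_add, map_smul, map_smul] at this
    simp only [smul_eq_mul] at this
    linarith
  have R : ∀ u c c', om n u c * f (br n u c') = om n u c' * f (br n u c) := by
    intro u c c'
    have := L c c' u
    rw [om_swap hn u c, om_swap hn u c', br_swap u c, br_swap u c', map_neg, map_neg] at this
    linarith
  obtain ⟨u, c, huc⟩ : ∃ u c, om n u c ≠ 0 := by
    by_contra! hcon
    have := om_nondeg hn (fun _ => 1) (hcon _)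
    have h2 := congrFun this ⟨0, by omega⟩
    simp at h2
  have key : ∀ u' c', om n u' c ≠ 0 → f (br n u' c') = (f (br n u c) / om n u c) * om n u' c' := by
    intro u' c' h0
    have h1 := L u u' c
    have h2 := R u' c c'
    field_simp
    apply mul_left_cancel₀ h0
    linear_combination (om n u c) * h2 + om n u' c' * h1
  refine ⟨f (br n u c) / om n u c, fun u' c' => ?_⟩
  by_cases h0 : om n u' c = 0
  · have h1 := key (u' + u) c' (by rwa [om_add_left, h0, zero_add])
    have h2 := key u c' huc
    rw [om_add_left, br_add_left, map_add] at h1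
    linarith
  · exact key u' c' h0

theorem W_span (hn : 2 ≤ n) (X : Mat n) (hX : X ∈ WSet n) :
    X = ∑ i, ∑ j, ((1/2 : ℝ) * (-(X * Jmat n)) i j) • br n (Pi.single i 1) (Pi.single j 1) := by
  have hX' := (mem_W n hn X).1 hX
  set A : Mat n := -(X * Jmat n) with hA
  have hXA : X = A * Jmat n := by
    rw [hA, Matrix.neg_mul, Matrix.mul_assoc, Jmat_mul_self n hn]; simp
  have hAt : Aᵀ = -A := by
    have h1 : Xᵀ = - (Jmat n * X * Jmat n) := by
      rw [← hX'.2, Matrix.mul_assoc, Jmat_mul_self n hn]; simp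
    rw [hA, Matrix.transpose_neg, Matrix.transpose_mul, Jmat_transpose n hn, h1, Matrix.mul_assoc]
    simp [JJ_mul n hn]
  rw [hXA]
  simp only [br, ← Matrix.smul_mul, ← Finset.sum_mul]
  congr 1
  ext i j
  have hij : A j i = - A i j := congrFun (congrFun hAt i) j
  simp only [Matrix.sum_apply, Matrix.smul_apply, Matrix.sub_apply, Matrix.vecMulVec_apply,
    Pi.single_apply, smul_eq_mul, mul_sub, Finset.sum_sub_distrib]
  simp
  rw [hij]; ring

theorem not_scalar (hn : 2 ≤ n) (X : Mat n) (hX : X.trace = 0) (h0 : X ≠ 0) :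
    ∃ v, v ≠ 0 ∧ ∀ c : ℝ, X *ᵥ v ≠ c • v := by
  by_contra! hcon
  obtain ⟨a, ha⟩ := (Matrix.toLin' X).exists_eq_smul_id_of_forall_notLinearIndependent fun v ↦ by
    by_cases hv : v = 0
    · simp [hv, linearIndependent_fin2]
    · obtain ⟨c, hc⟩ := hcon v hv
      rw [LinearIndependent.pair_iff' hv]
      push Not
      exact ⟨c, by rw [Matrix.toLin'_apply, hc]⟩
  have hXa : X = a • (1 : Mat n) := by
    apply Matrix.toLin'.injective
    rw [ha]
    ext i j
    simp
  rw [hXa, Matrix.trace_smul, Matrix.trace_one] at hX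
  have ha0 : a = 0 := by
    rcases mul_eq_zero.1 hX with h | h
    · exact h
    · exfalso
      simp at h
      omega
  exact h0 (by rw [hXa, ha0, zero_smul])

theorem part3 (hn : 2 ≤ n) (W' : Submodule ℝ (Mat n)) (hW : (W' : Set (Mat n)) ⊆ WSet n)
    (h : ∀ Y ∈ spSet n, ∀ X ∈ W', Y * X - X * Y ∈ W') :
      (W' : Set (Mat n)) = {0} ∨ (W' : Set (Mat n)) = WSet n := by
  by_cases hb : W' = ⊥
  · left; simp [hb]
  right
  obtain ⟨X, hX, hX0⟩ := (Submodule.ne_bot_iff _).1 hb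
  obtain ⟨v, hv, hw⟩ := not_scalar hn X (hW hX).1 hX0
  have all := stepAll hn W' hW h v (X *ᵥ v) hv hw (act hn W' hW h X hX v)
  apply Set.Subset.antisymm hW
  intro Z hZ
  by_contra hZW
  obtain ⟨f, hf, hle⟩ := Submodule.exists_le_ker_of_notMem (p := W') hZW
  obtain ⟨l, hl⟩ := om_prop hn f (fun u c huc => hle (all u c huc))
  apply hf
  have hfe : ∀ u c, f (br n u c) = (-l/2) * (br n u c).trace := by
    intro u c; rw [hl, br_trace hn]; ring
  have e : f Z = (-l/2) * Z.trace := by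
    rw [W_span hn Z hZ]
    simp only [map_sum, map_smul, hfe, Matrix.trace_sum, Matrix.trace_smul, Finset.mul_sum,
      smul_eq_mul]
    refine Finset.sum_congr rfl fun i _ => Finset.sum_congr rfl fun j _ => by ring
  rw [e, hZ.1, mul_zero]

end

/-- Appendix: `sl_{2n}(ℝ) = sp(2n,ℝ) ⊕ W` as vector spaces, `W` is invariant under the
adjoint action of `sp(2n,ℝ)`, and `W` is an irreducible `sp(2n,ℝ)`-module. -/
theorem stmt14 (n : ℕ) (hn : 2 ≤ n) :
    (∀ X : Mat n, X.trace = 0 →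
      ∃! p : Mat n × Mat n, p.1 ∈ spSet n ∧ p.2 ∈ WSet n ∧ X = p.1 + p.2) ∧
    (∀ Y ∈ spSet n, ∀ X ∈ WSet n, Y * X - X * Y ∈ WSet n) ∧
    (∀ W' : Submodule ℝ (Mat n), (W' : Set (Mat n)) ⊆ WSet n →
      (∀ Y ∈ spSet n, ∀ X ∈ W', Y * X - X * Y ∈ W') →
      (W' : Set (Mat n)) = {0} ∨ (W' : Set (Mat n)) = WSet n) :=
  ⟨part1 n hn, part2 n hn, part3 hn⟩
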